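/- Let τ, t*, T₃ be real numbers with 1 < τ < 2, 2 < t* < 3, 3 < T₃ < 4 satisfying τ = T₃ − 2·cos(3(τ − 1)/4), t* = 1 + (2/3)·arccos(−2/3) − (τ − 1)/3, and T₃ = t* + sin((3(t* − 1) + (τ − 1))/2) (numerically τ ≈ 1.2319, t* ≈ 2.4564, T₃ ≈ 3.2017). Then, in the priority evacuation model with 3 servants, for every trajectories Q, S₁, S₂, S₃ and every real B, if they evacuate the queen in time B then B ≥ T₃. -/

import Mathlib

open Real Set MeasureTheory
open scoped RealInnerProductSpace

noncomputable section

abbrev Plane : Type := EuclideanSpace ℝ (Fin 2)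

/-- The point of the unit circle at angle `θ`. -/
def circlePt (θ : ℝ) : Plane := (WithLp.equiv 2 (Fin 2 → ℝ)).symm ![Real.cos θ, Real.sin θ]

/-- A trajectory in the priority evacuation model: a `1`-Lipschitz function on `[0, ∞)`
starting at the origin. -/
def IsTraj (f : ℝ → Plane) : Prop :=
  LipschitzOnWith 1 f (Set.Ici 0) ∧ f 0 = 0

/-- The first-visit time of the point `p` by the queen `Q` or one of the servants `S i`. -/
def visitTime {n : ℕ} (Q : ℝ → Plane) (S : Fin n → ℝ → Plane) (p : Plane) : ℝ :=
  sInf {t : ℝ | 0 ≤ t ∧ (Q t = p ∨ ∃ i, S i t = p)}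

/-- The trajectories `Q` (queen) and `S 0, …, S (n-1)` (servants) evacuate the queen in
time `B`: every point of the unit circle is visited, and the first-visit time plus the
distance from the queen (at that moment) to the point is at most `B`. -/
def Evacuates {n : ℕ} (Q : ℝ → Plane) (S : Fin n → ℝ → Plane) (B : ℝ) : Prop :=
  ∀ p : Plane, ‖p‖ = 1 →
    (∃ t : ℝ, 0 ≤ t ∧ (Q t = p ∨ ∃ i, S i t = p)) ∧
    visitTime Q S p + ‖Q (visitTime Q S p) - p‖ ≤ B

/-- The set of angles in `[0, 2π)` whose circle point is visited by the queen at some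
time in `Tset`; its Lebesgue measure is the arc measure of the queen-explored set. -/
def queenArc (Q : ℝ → Plane) (Tset : Set ℝ) : Set ℝ :=
  {θ : ℝ | θ ∈ Set.Ico 0 (2 * π) ∧ ∃ s ∈ Tset, Q s = circlePt θ}

lemma norm_circlePt_sub (x y : ℝ) :
    ‖circlePt x - circlePt y‖ = 2 * |Real.sin ((x - y) / 2)| := by
  have h : ‖circlePt x - circlePt y‖ ^ 2 = (2 * |Real.sin ((x - y) / 2)|) ^ 2 := by
    rw [EuclideanSpace.norm_sq_eq]
    simp only [circlePt, Fin.sum_univ_two, mul_pow, sq_abs]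
    simp only [WithLp.equiv_symm_apply, PiLp.sub_apply, Matrix.cons_val_zero, Matrix.cons_val_one,
      Real.norm_eq_abs, sq_abs]
    rw [Real.cos_sub_cos, Real.sin_sub_sin]
    linear_combination 4 * Real.sin ((x - y) / 2) ^ 2 * Real.sin_sq_add_cos_sq ((x + y) / 2)
  exact (pow_left_inj₀ (norm_nonneg _) (by positivity) two_ne_zero).1 h

lemma norm_circlePt (x : ℝ) : ‖circlePt x‖ = 1 := by
  rw [EuclideanSpace.norm_eq]
  simp [circlePt, Fin.sum_univ_two]

lemma exists_eq_circlePt {p : Plane} (hp : ‖p‖ = 1) : ∃ φ, p = circlePt φ := by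
  have h : p 0 ^ 2 + p 1 ^ 2 = 1 := by
    have h := EuclideanSpace.norm_sq_eq p
    simp only [hp, Fin.sum_univ_two, Real.norm_eq_abs, sq_abs] at h
    linarith
  have hz : ‖(⟨p 0, p 1⟩ : ℂ)‖ = 1 := by
    rw [← pow_left_inj₀ (norm_nonneg _) zero_le_one two_ne_zero, Complex.sq_norm,
      Complex.normSq_mk]
    linarith
  have hz0 : (⟨p 0, p 1⟩ : ℂ) ≠ 0 := by
    intro h0
    simp [h0] at hz
  refine ⟨Complex.arg ⟨p 0, p 1⟩, ?_⟩
  ext i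
  fin_cases i
  · simp [circlePt, Complex.cos_arg hz0, hz]
  · simp [circlePt, Complex.sin_arg, hz]

lemma circlePt_sub_two_pi (x : ℝ) : circlePt (x - 2 * π) = circlePt x := by
  simp [circlePt]

lemma IsTraj.norm_sub_le {f : ℝ → Plane} (hf : IsTraj f) {s t : ℝ} (hs : 0 ≤ s) (ht : 0 ≤ t) :
    ‖f s - f t‖ ≤ |s - t| := by
  simpa [dist_eq_norm] using hf.1.dist_le_mul s hs t ht

lemma IsTraj.one_le_of_eq_circlePt {f : ℝ → Plane} (hf : IsTraj f) {s θ : ℝ} (hs : 0 ≤ s)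
    (h : f s = circlePt θ) : 1 ≤ s := by
  have h1 := hf.norm_sub_le hs le_rfl
  rwa [hf.2, h, sub_zero, sub_zero, norm_circlePt, abs_of_nonneg hs] at h1

/-- On arcs shorter than the full circle, short chords are almost as long as their arcs. -/
lemma exists_chord_bound {c w : ℝ} (hc : 0 < c) (hc1 : c < 1) (hw : w < 2 * π) :
    ∃ δ₀ > 0, ∀ δ ≤ δ₀, ∀ d, 0 ≤ d → d ≤ w → 2 * Real.sin (d / 2) ≤ δ → c * d ≤ δ := by
  obtain ⟨e, he, he1, he2⟩ : ∃ e > 0, e ≤ 1 - c ∧ e ≤ 2 * π - w :=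
    ⟨min (1 - c) (2 * π - w), lt_min (by linarith) (by linarith), min_le_left _ _, min_le_right _ _⟩
  have hpi := Real.pi_gt_three
  have hs : 0 < Real.sin (e / 2) := Real.sin_pos_of_pos_of_lt_pi (by linarith) (by linarith)
  refine ⟨Real.sin (e / 2), hs, fun δ hδ d hd hdw h ↦ ?_⟩
  rcases le_or_gt d e with hde | hde
  · have h1 := Real.sin_ge_sub_cube (x := d / 2) (by linarith)
    have h2 : d ^ 2 ≤ e := by nlinarith
    nlinarith [mul_le_mul_of_nonneg_left h2 hd]
  · exfalso
    have h1 := strictConcaveOn_sin_Icc.concaveOn.min_le_of_mem_Icc (x := e / 2) (y := π - e / 2)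
      (z := d / 2) ⟨by linarith, by linarith⟩ ⟨by linarith, by linarith⟩
      ⟨by linarith, by linarith⟩
    rw [Real.sin_pi_sub, min_self] at h1
    linarith

/-- A unit-speed trajectory visits by time `T` a part of the circle of measure at most `T - 1`. -/
lemma IsTraj.volume_visited_le {f : ℝ → Plane} (hf : IsTraj f) {T a b : ℝ} (hT : 1 ≤ T)
    (hab : b - a < 2 * π) :
    volume {θ | θ ∈ Icc a b ∧ ∃ s ∈ Icc 0 T, f s = circlePt θ} ≤ ENNReal.ofReal (T - 1) := by
  refine ENNReal.le_of_forall_pos_le_add fun ε hε _ ↦ ?_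
  have hε' : (0 : ℝ) < ε := hε
  rw [← ENNReal.ofReal_coe_nnreal, ← ENNReal.ofReal_add (by linarith) hε'.le]
  obtain ⟨c, hc, hc1, hcT⟩ : ∃ c > 0, c < 1 ∧ T - 1 + ε / 2 = c * (T - 1 + ε) :=
    ⟨(T - 1 + ε / 2) / (T - 1 + ε), by positivity,
      (div_lt_one (by linarith)).2 (by linarith),
      (div_mul_cancel₀ _ (ne_of_gt (by linarith))).symm⟩
  obtain ⟨δ₀, hδ₀, hδ⟩ := exists_chord_bound hc hc1 hab
  set δ := min δ₀ (ε / 2)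
  have hδpos : 0 < δ := lt_min hδ₀ (by linarith)
  have hδε : δ ≤ ε / 2 := min_le_right _ _
  set N := ⌊(T - 1) / δ⌋₊
  set A : ℕ → Set ℝ := fun j ↦
    {θ | θ ∈ Icc a b ∧ ∃ s ∈ Icc (1 + j * δ) (1 + (j + 1) * δ), f s = circlePt θ}
  have hsub : {θ | θ ∈ Icc a b ∧ ∃ s ∈ Icc 0 T, f s = circlePt θ} ⊆
      ⋃ j ∈ Finset.range (N + 1), A j := by
    rintro θ ⟨hθ, s, hs, hfs⟩
    have h1 := hf.one_le_of_eq_circlePt hs.1 hfs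
    have h2 := Nat.floor_le (div_nonneg (sub_nonneg.2 h1) hδpos.le)
    have h3 := (Nat.lt_floor_add_one ((s - 1) / δ)).le
    rw [le_div_iff₀ hδpos] at h2
    rw [div_le_iff₀ hδpos] at h3
    refine mem_biUnion (x := ⌊(s - 1) / δ⌋₊) ?_ ⟨hθ, s, ⟨by linarith, by linarith⟩, hfs⟩
    simp only [Finset.coe_range, mem_Iio, Nat.lt_succ_iff]
    exact Nat.floor_mono (by gcongr; exact hs.2)
  have hAj : ∀ j, volume (A j) ≤ ENNReal.ofReal (δ / c) := by
    intro j
    refine (Real.volume_le_diam _).trans (Metric.ediam_le ?_)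
    rintro x ⟨hx, s, hs, hfs⟩ y ⟨hy, r, hr, hfr⟩
    have hj : (0 : ℝ) ≤ j * δ := by positivity
    rw [edist_dist, Real.dist_eq]
    refine ENNReal.ofReal_le_ofReal ?_
    rw [le_div_iff₀ hc, mul_comm]
    have hd : |x - y| ≤ b - a := abs_sub_le_iff.2 ⟨by linarith [hx.2, hy.1], by linarith [hx.1, hy.2]⟩
    refine hδ δ (min_le_left _ _) _ (abs_nonneg _) hd ?_
    have h1 : ‖circlePt x - circlePt y‖ ≤ |s - r| := by
      rw [← hfs, ← hfr]
      exact hf.norm_sub_le (by linarith [hs.1]) (by linarith [hr.1])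
    have h2 : |s - r| ≤ δ := abs_sub_le_iff.2 ⟨by linarith [hs.2, hr.1], by linarith [hs.1, hr.2]⟩
    rw [norm_circlePt_sub] at h1
    have h3 : Real.sin (|x - y| / 2) ≤ |Real.sin ((x - y) / 2)| := by
      rcases abs_cases (x - y) with ⟨h, _⟩ | ⟨h, _⟩
      · rw [h]; exact le_abs_self _
      · rw [h, neg_div, Real.sin_neg]; exact neg_le_abs _
    linarith
  have hNle : (N + 1) * (δ / c) ≤ T - 1 + ε := by
    have h1 : (N : ℝ) ≤ (T - 1) / δ := Nat.floor_le (div_nonneg (by linarith) hδpos.le)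
    rw [le_div_iff₀ hδpos] at h1
    rw [← mul_div_assoc, div_le_iff₀ hc]
    linarith
  calc volume _ ≤ volume (⋃ j ∈ Finset.range (N + 1), A j) := measure_mono hsub
    _ ≤ ∑ j ∈ Finset.range (N + 1), volume (A j) := measure_biUnion_finset_le _ _
    _ ≤ ∑ j ∈ Finset.range (N + 1), ENNReal.ofReal (δ / c) := Finset.sum_le_sum fun j _ ↦ hAj j
    _ = ENNReal.ofReal ((N + 1) * (δ / c)) := by
      rw [Finset.sum_const, Finset.card_range, nsmul_eq_mul, ENNReal.ofReal_mul (by positivity)]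
      congr 1
      rw [← Nat.cast_succ, ENNReal.ofReal_natCast]
    _ ≤ ENNReal.ofReal (T - 1 + ε) := ENNReal.ofReal_le_ofReal hNle

/-- An arc longer than what the servants can explore by time `t` and the queen by time `r`
contains an unexplored point. -/
lemma exists_unvisited {n : ℕ} {Q : ℝ → Plane} {S : Fin n → ℝ → Plane} (hQ : IsTraj Q)
    (hS : ∀ i, IsTraj (S i)) {t r a b : ℝ} (ht : 1 ≤ t) (hr : 1 ≤ r) (hab : b - a < 2 * π)
    (h : n * (t - 1) + (r - 1) < b - a) :
    ∃ θ ∈ Icc a b, (∀ i, ∀ s ∈ Icc 0 t, S i s ≠ circlePt θ) ∧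
      ∀ s ∈ Icc 0 r, Q s ≠ circlePt θ := by
  by_contra! hcon
  have hsub : Icc a b ⊆ (⋃ i, {θ | θ ∈ Icc a b ∧ ∃ s ∈ Icc 0 t, S i s = circlePt θ}) ∪
      {θ | θ ∈ Icc a b ∧ ∃ s ∈ Icc 0 r, Q s = circlePt θ} := by
    intro θ hθ
    by_cases hv : ∀ i, ∀ s ∈ Icc 0 t, S i s ≠ circlePt θ
    · exact Or.inr ⟨hθ, hcon θ hθ hv⟩
    · push Not at hv
      obtain ⟨i, hi⟩ := hv
      exact Or.inl (mem_iUnion.2 ⟨i, hθ, hi⟩)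
  have hvol : ENNReal.ofReal (b - a) ≤ ENNReal.ofReal (n * (t - 1) + (r - 1)) := by
    calc ENNReal.ofReal (b - a) = volume (Icc a b) := Real.volume_Icc.symm
      _ ≤ _ := measure_mono hsub
      _ ≤ _ := measure_union_le _ _
      _ ≤ (∑ i : Fin n, ENNReal.ofReal (t - 1)) + ENNReal.ofReal (r - 1) := by
        gcongr
        · exact (measure_iUnion_fintype_le _ _).trans
            (Finset.sum_le_sum fun i _ ↦ (hS i).volume_visited_le ht hab)
        · exact hQ.volume_visited_le hr hab
      _ = _ := by
        rw [ENNReal.ofReal_add (mul_nonneg n.cast_nonneg (by linarith)) (by linarith),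
          ENNReal.ofReal_mul n.cast_nonneg]
        simp
  have h0 : 0 ≤ n * (t - 1) + (r - 1) :=
    add_nonneg (mul_nonneg n.cast_nonneg (by linarith)) (by linarith)
  exact absurd ((ENNReal.ofReal_le_ofReal_iff h0).1 hvol) (not_le.2 h)

lemma Evacuates.le_of_unvisited {n : ℕ} {Q : ℝ → Plane} {S : Fin n → ℝ → Plane} {B : ℝ}
    (hB : Evacuates Q S B) (hQ : IsTraj Q) {t : ℝ} (ht : 0 ≤ t) {p : Plane} (hp : ‖p‖ = 1)
    (hSp : ∀ i, ∀ s ∈ Icc 0 t, S i s ≠ p) (hQp : ∀ s, 0 ≤ s → s < t → Q s ≠ p) :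
    t + ‖Q t - p‖ ≤ B := by
  obtain ⟨hne, hle⟩ := hB p hp
  have hv : t ≤ visitTime Q S p := by
    refine le_csInf hne ?_
    rintro s ⟨hs, h⟩
    by_contra! hst
    rcases h with h | ⟨i, h⟩
    · exact hQp s hs hst h
    · exact hSp i s ⟨hs, hst.le⟩ h
  set v := visitTime Q S p
  have h1 := hQ.norm_sub_le ht (ht.trans hv)
  rw [abs_sub_comm, abs_of_nonneg (sub_nonneg.2 hv)] at h1
  have h2 := norm_sub_le_norm_sub_add_norm_sub (Q t) (Q v) p
  linarith

/-- A queen on the circle at time `t`, who between times `r` and `t` has explored nothing near the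
point opposite to her, is far from some unexplored point. -/
lemma Evacuates.le_of_queen_on_circle {n : ℕ} {Q : ℝ → Plane} {S : Fin n → ℝ → Plane} {B : ℝ}
    (hB : Evacuates Q S B) (hQ : IsTraj Q) (hS : ∀ i, IsTraj (S i)) {t r : ℝ} (ht : 1 ≤ t)
    (hr : 1 ≤ r) {β : ℝ} (hβ : β = (n * (t - 1) + (r - 1)) / 4) (hβπ : β < π / 2)
    (hQt : ‖Q t‖ = 1) {ρ : ℝ} (hρ : ρ < 2 * Real.cos β)
    (hgap : ∀ s θ, r < s → s < t → Q s = circlePt θ → ‖Q t - circlePt θ‖ ≤ ρ) :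
    t + 2 * Real.cos β ≤ B := by
  by_contra! hlt
  obtain ⟨φ, hφ⟩ := exists_eq_circlePt hQt
  have hβ0 : 0 ≤ β := by
    rw [hβ]
    exact div_nonneg (add_nonneg (mul_nonneg n.cast_nonneg (by linarith)) (by linarith)) (by simp)
  obtain ⟨e, he, he'⟩ := exists_between (lt_min (sub_pos.2 hβπ)
    (lt_min (div_pos (sub_pos.2 hρ) two_pos) (div_pos (sub_pos.2 hlt) two_pos)))
  rw [lt_min_iff, lt_min_iff] at he'
  obtain ⟨he1, he2, he3⟩ := he'
  have hcos : Real.cos β - e ≤ Real.cos (β + e) := by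
    have h := (abs_le.1 (Real.abs_cos_sub_cos_le β (β + e))).2
    rw [show β - (β + e) = -e by ring, abs_neg, abs_of_pos he] at h
    linarith
  obtain ⟨θ, hθ, hSθ, hQθ⟩ := exists_unvisited hQ hS ht hr
    (a := φ + π - 2 * (β + e)) (b := φ + π + 2 * (β + e)) (by linarith) (by linarith)
  have hdist : 2 * Real.cos β - 2 * e ≤ ‖Q t - circlePt θ‖ := by
    rw [hφ, norm_circlePt_sub, show (φ - θ) / 2 = -((θ - φ - π) / 2 + π / 2) by ring,
      Real.sin_neg, Real.sin_add_pi_div_two, abs_neg]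
    have habs : |(θ - φ - π) / 2| ≤ β + e :=
      abs_le.2 ⟨by linarith [hθ.1], by linarith [hθ.2]⟩
    have h := Real.cos_le_cos_of_nonneg_of_le_pi (abs_nonneg _) (by linarith [Real.pi_pos]) habs
    rw [Real.cos_abs] at h
    linarith [le_abs_self (Real.cos ((θ - φ - π) / 2))]
  have h := hB.le_of_unvisited hQ (by linarith : (0 : ℝ) ≤ t) (norm_circlePt θ) hSθ
    fun s hs hst hQs ↦ by
    rcases le_or_gt s r with hsr | hsr
    · exact hQθ s ⟨hs, hsr⟩ hQs
    · linarith [hgap s θ hsr hst hQs]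
  linarith

lemma le_four_thirds_mul_add_two_cos {m x₁ x₂ x : ℝ} (h1 : 0 ≤ x₁) (h2 : x₂ ≤ π / 2)
    (hx : x ∈ Icc x₁ x₂) (hm1 : m ≤ 4 / 3 * x₁ + 2 * Real.cos x₁)
    (hm2 : m ≤ 4 / 3 * x₂ + 2 * Real.cos x₂) : m ≤ 4 / 3 * x + 2 * Real.cos x := by
  have hc : ConcaveOn ℝ (Icc (-(π / 2)) (π / 2)) fun x ↦ 4 / 3 * x + 2 * Real.cos x :=
    ((concaveOn_id (convex_Icc _ _)).smul (by norm_num : (0 : ℝ) ≤ 4 / 3)).add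
      (strictConcaveOn_cos_Icc.concaveOn.smul zero_le_two)
  have h12 := hx.1.trans hx.2
  have hpi := Real.pi_pos
  exact (le_min hm1 hm2).trans (hc.min_le_of_mem_Icc (x := x₁) (y := x₂)
    ⟨by linarith, by linarith⟩ ⟨by linarith, h2⟩ hx)

/-- If the queen is off the circle between times `r` and `t` and `n (t - 1) + (r - 1) = 2 a`, then
some two points unexplored at time `t` are almost `2 sin a` apart, and
she is far from one of them. -/
lemma Evacuates.le_of_queen_inside {n : ℕ} {Q : ℝ → Plane} {S : Fin n → ℝ → Plane} {B : ℝ}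
    (hB : Evacuates Q S B) (hQ : IsTraj Q) (hS : ∀ i, IsTraj (S i)) {t r : ℝ} (ht : 1 ≤ t)
    (hr : 1 ≤ r) {a : ℝ} (ha : a = (n * (t - 1) + (r - 1)) / 2) (ha1 : 2 * π / 3 ≤ a)
    (ha2 : a < π) (hin : ∀ s, r < s → s < t → ‖Q s‖ ≠ 1) :
    t + Real.sin a ≤ B := by
  by_contra! hlt
  set U : Set ℝ := {θ | (∀ i, ∀ s ∈ Icc 0 t, S i s ≠ circlePt θ) ∧
    ∀ s ∈ Icc 0 r, Q s ≠ circlePt θ} with hU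
  have hUper : ∀ θ ∈ U, θ - 2 * π ∈ U := fun θ hθ ↦ by
    simpa only [hU, mem_ofPred_eq, circlePt_sub_two_pi] using hθ
  have hUdist : ∀ θ ∈ U, ‖Q t - circlePt θ‖ ≤ B - t := fun θ hθ ↦ by
    have h := hB.le_of_unvisited hQ (by linarith : (0 : ℝ) ≤ t) (norm_circlePt θ) hθ.1
      fun s hs hst hQs ↦ by
        rcases le_or_gt s r with hsr | hsr
        · exact hθ.2 s ⟨hs, hsr⟩ hQs
        · exact hin s hsr hst (by rw [hQs, norm_circlePt])
    linarith
  have hpair : ∀ x ∈ U, ∀ y ∈ U, |Real.sin ((x - y) / 2)| ≤ B - t := fun x hx y hy ↦ by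
    have h1 := norm_circlePt_sub x y
    have h2 := norm_sub_le_norm_sub_add_norm_sub (circlePt x) (Q t) (circlePt y)
    rw [norm_sub_rev (circlePt x) (Q t)] at h2
    linarith [hUdist x hx, hUdist y hy]
  have hpi := Real.pi_pos
  have hunv : ∀ x y, y - x < 2 * π → 2 * a < y - x → ∃ θ ∈ U, θ ∈ Icc x y := fun x y h1 h2 ↦ by
    obtain ⟨θ, hθ, h⟩ := exists_unvisited hQ hS ht hr h1 (by linarith)
    exact ⟨θ, h, hθ⟩
  obtain ⟨u, hu, -⟩ := hunv 0 (a + π) (by linarith) (by linarith)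
  have hB0 : 0 ≤ B - t := (norm_nonneg _).trans (hUdist u hu)
  obtain ⟨z, hz0, hza, hz⟩ : ∃ z, 0 ≤ z ∧ z < π - a ∧ B - t = Real.sin z := by
    have h1 : B - t < 1 := by linarith [Real.sin_le_one a]
    refine ⟨Real.arcsin (B - t), Real.arcsin_nonneg.2 hB0, ?_,
      (Real.sin_arcsin (by linarith) h1.le).symm⟩
    rw [Real.arcsin_lt_iff_lt_sin ⟨by linarith, h1.le⟩ ⟨by linarith, by linarith⟩, Real.sin_pi_sub]
    linarith
  have hclose : ∀ x ∈ U, ∀ y ∈ U, |x - y| < 2 * π - 2 * z → |x - y| ≤ 2 * z := by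
    intro x hx y hy hxy
    by_contra! hcon
    have h1 := hpair x hx y hy
    have h2 : |Real.sin ((x - y) / 2)| = Real.sin (|x - y| / 2) := by
      have h0 : 0 ≤ Real.sin (|x - y| / 2) :=
        Real.sin_nonneg_of_nonneg_of_le_pi (by positivity) (by linarith)
      rcases abs_cases (x - y) with ⟨h, _⟩ | ⟨h, _⟩
      · rw [h] at h0 ⊢; exact abs_of_nonneg h0
      · rw [← abs_of_nonneg h0, h, neg_div, Real.sin_neg, abs_neg]
    have h3 := strictConcaveOn_sin_Icc.lt_on_openSegment (x := z) (y := π - z)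
      (z := |x - y| / 2) ⟨hz0, by linarith⟩ ⟨by linarith, by linarith⟩ (by linarith)
      (by rw [openSegment_eq_Ioo (by linarith)]; exact ⟨by linarith, by linarith⟩)
    rw [Real.sin_pi_sub, min_self] at h3
    linarith
  set V : Set ℝ := U ∩ Icc (u - π) (u + π)
  have hVu : ∀ θ ∈ V, |θ - u| ≤ 2 * z := fun θ hθ ↦ by
    have h : |θ - u| ≤ π := abs_le.2 ⟨by linarith [hθ.2.1], by linarith [hθ.2.2]⟩
    exact hclose θ hθ.1 u hu (by linarith)
  have huV : u ∈ V := ⟨hu, by linarith, by linarith⟩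
  have hbdd : BddBelow V := ⟨u - π, fun θ hθ ↦ hθ.2.1⟩
  obtain ⟨m, hmV, hmu, hVm⟩ : ∃ m, (∀ θ ∈ V, m ≤ θ) ∧ u - 2 * z ≤ m ∧ ∀ θ ∈ V, θ ≤ m + 2 * z := by
    refine ⟨sInf V, fun θ hθ ↦ csInf_le hbdd hθ, ?_, fun θ hθ ↦ ?_⟩
    · exact le_csInf ⟨u, huV⟩ fun θ hθ ↦ by linarith [(abs_le.1 (hVu θ hθ)).1]
    · suffices h : θ - 2 * z ≤ sInf V by linarith
      refine le_csInf ⟨u, huV⟩ fun η hη ↦ ?_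
      have h1 := abs_le.1 (hVu θ hθ)
      have h2 := abs_le.1 (hVu η hη)
      have h3 : |θ - η| < 2 * π - 2 * z := abs_lt.2 ⟨by linarith, by linarith⟩
      linarith [(abs_le.1 (hclose θ hθ.1 η hη.1 h3)).2]
  have hmu' := hmV u huV
  obtain ⟨e, he, he'⟩ := exists_between (by linarith : 0 < π - a - z)
  obtain ⟨θ, hθ, hθ1, hθ2⟩ := hunv (m + 2 * z + e) (m + 2 * π - e) (by linarith) (by linarith)
  rcases le_or_gt θ (u + π) with h | h
  · linarith [hVm θ ⟨hθ, by linarith, h⟩]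
  · linarith [hmV (θ - 2 * π) ⟨hUper θ hθ, by linarith, by linarith⟩]

lemma arccos_neg_two_thirds_mem :
    Real.arccos (-2 / 3) ∈ Icc (2 * π / 3) (π / 2 + 0.76) := by
  have hpi := Real.pi_gt_three
  constructor
  · have h : Real.arccos (Real.cos (2 * π / 3)) = 2 * π / 3 :=
      Real.arccos_cos (by linarith) (by linarith)
    rw [← h]
    refine Real.arccos_le_arccos ?_
    rw [show 2 * π / 3 = π - π / 3 by ring, Real.cos_pi_sub, Real.cos_pi_div_three]
    norm_num
  · have h1 := Real.sin_ge_sub_cube (x := 0.76) (by norm_num)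
    have h2 : Real.arcsin (2 / 3) ≤ 0.76 :=
      (Real.arcsin_le_iff_le_sin ⟨by norm_num, by norm_num⟩ ⟨by linarith, by linarith⟩).2
        (by norm_num at h1 ⊢; linarith)
    rw [Real.arccos_eq_pi_div_two_sub_arcsin, neg_div, Real.arcsin_neg]
    linarith

lemma sin_arccos_neg_two_thirds_lt : Real.sin (Real.arccos (-2 / 3)) < 0.7455 := by
  rw [Real.sin_arccos, Real.sqrt_lt' (by norm_num)]
  norm_num

lemma lt_two_mul_cos_half_arccos_neg_two_thirds :
    0.81 < 2 * Real.cos (Real.arccos (-2 / 3) / 2) := by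
  have h := Real.cos_sq (Real.arccos (-2 / 3) / 2)
  rw [mul_div_cancel₀ _ two_ne_zero, Real.cos_arccos (by norm_num) (by norm_num)] at h
  have h0 : 0 ≤ Real.cos (Real.arccos (-2 / 3) / 2) :=
    Real.cos_nonneg_of_mem_Icc ⟨by linarith [Real.arccos_nonneg (-2 / 3), Real.pi_pos],
      by linarith [Real.arccos_le_pi (-2 / 3)]⟩
  nlinarith

lemma le_of_queen_time_eq {τ T : ℝ} (hτ : 1 < τ) (hτ' : τ < 2) (hT : T ≤ 3.2998 - (τ - 1) / 3)
    (h : τ = T - 2 * Real.cos (3 * (τ - 1) / 4)) : τ ≤ 1.26 := by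
  have h := Real.one_sub_sq_div_two_le_cos (x := 3 * (τ - 1) / 4)
  nlinarith

/-- with three servants, any evacuation of the queen takes time at least
`T₃ ≈ 3.2017`, where `T₃` is defined by the stated system of equations. -/
theorem priority_evacuation_three_servants_lower_bound
    (τ tstar T₃ : ℝ)
    (hτ : 1 < τ) (hτ' : τ < 2) (hts : 2 < tstar) (hts' : tstar < 3)
    (hT : 3 < T₃) (hT' : T₃ < 4)
    (e1 : τ = T₃ - 2 * Real.cos (3 * (τ - 1) / 4))
    (e2 : tstar = 1 + (2 / 3) * Real.arccos (-2 / 3) - (τ - 1) / 3)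
    (e3 : T₃ = tstar + Real.sin ((3 * (tstar - 1) + (τ - 1)) / 2))
    (Q : ℝ → Plane) (S : Fin 3 → ℝ → Plane)
    (hQ : IsTraj Q) (hS : ∀ i, IsTraj (S i))
    (B : ℝ) (hB : Evacuates Q S B) :
    T₃ ≤ B := by
  set a := Real.arccos (-2 / 3) with ha_def
  obtain ⟨ha1, ha2⟩ := arccos_neg_two_thirds_mem
  rw [← ha_def] at ha1 ha2
  have hpi := Real.pi_gt_three
  have hpi' := Real.pi_lt_d4
  have hx : (3 * (tstar - 1) + (τ - 1)) / 2 = a := by linarith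
  rw [hx] at e3
  have hsina : Real.sin a < 0.7455 := sin_arccos_neg_two_thirds_lt
  have hcosa2 : 0.81 < 2 * Real.cos (a / 2) := lt_two_mul_cos_half_arccos_neg_two_thirds
  have hT_up : T₃ ≤ 3.2998 - (τ - 1) / 3 := by linarith
  have hτ_up : τ ≤ 1.26 := le_of_queen_time_eq hτ hτ' hT_up e1
  by_contra! hBT
  by_cases hon : ∃ s ∈ Icc τ tstar, ‖Q s‖ = 1
  · have hQc : ContinuousOn Q (Icc τ tstar) :=
      hQ.1.continuousOn.mono fun s hs ↦ by simpa using (by linarith [hs.1] : (0 : ℝ) ≤ s)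
    have hcpt : IsCompact (Icc τ tstar ∩ {s | ‖Q s‖ = 1}) := by
      refine isCompact_Icc.of_isClosed_subset ?_ inter_subset_left
      exact hQc.norm.preimage_isClosed_of_isClosed isClosed_Icc isClosed_singleton
    obtain ⟨s₀, hs₀, hs₀'⟩ := hon
    obtain ⟨t, ⟨ht, hQt⟩, htmin⟩ := hcpt.exists_isLeast ⟨s₀, hs₀, hs₀'⟩
    have hQt : ‖Q t‖ = 1 := hQt
    rcases le_or_gt t 2 with ht2 | ht2
    · have hcos := Real.one_sub_sq_div_two_le_cos (x := 3 / 4)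
      have hβ : 1 < 2 * Real.cos (3 * (t - 1) / 4) := by
        have h := Real.cos_le_cos_of_nonneg_of_le_pi (x := 3 * (t - 1) / 4) (y := 3 / 4)
          (by linarith [ht.1]) (by linarith) (by linarith)
        linarith
      have h1 := hB.le_of_queen_on_circle hQ hS (t := t) (r := 1) (β := 3 * (t - 1) / 4)
        (by linarith [ht.1]) le_rfl (by push_cast; ring) (by linarith) hQt hβ
        fun s θ hs hst hQs ↦ by
          have h := hQ.norm_sub_le (s := t) (t := s) (by linarith) (by linarith)
          rw [hQs, abs_of_pos (by linarith)] at h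
          linarith
      have h2 := le_four_thirds_mul_add_two_cos (m := T₃ - 1) (x₁ := 3 * (τ - 1) / 4)
        (x₂ := 3 / 4) (x := 3 * (t - 1) / 4) (by linarith) (by linarith)
        ⟨by linarith [ht.1], by linarith⟩ (by linarith) (by linarith)
      linarith
    · have h1 := hB.le_of_queen_on_circle hQ hS (t := t) (r := τ)
        (β := (3 * (t - 1) + (τ - 1)) / 4) (ρ := 2 * Real.cos ((3 * (t - 1) + (τ - 1)) / 4) - 1)
        (by linarith) hτ.le (by push_cast; ring) (by linarith [ht.2]) hQt (by linarith)
        fun s θ hs hst hQs ↦ by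
          have h := htmin ⟨⟨hs.le, hst.le.trans ht.2⟩, by
            rw [mem_ofPred_eq, hQs, norm_circlePt]⟩
          linarith
      have hcos := Real.one_sub_sq_div_two_le_cos (x := (3 + (τ - 1)) / 4)
      have hsq := pow_le_pow_left₀ (by linarith : 0 ≤ (3 + (τ - 1)) / 4)
        (by linarith : (3 + (τ - 1)) / 4 ≤ 0.815) 2
      have h2 := le_four_thirds_mul_add_two_cos (m := T₃ - 1 + (τ - 1) / 3)
        (x₁ := (3 + (τ - 1)) / 4) (x₂ := a / 2) (x := (3 * (t - 1) + (τ - 1)) / 4)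
        (by linarith) (by linarith) ⟨by linarith, by linarith [ht.2]⟩ (by linarith) (by linarith)
      linarith
  · push Not at hon
    have h := hB.le_of_queen_inside hQ hS (t := tstar) (r := τ) (a := a) (by linarith) hτ.le
      (by push_cast; linarith) ha1 (by linarith) fun s hs hst ↦ hon s ⟨hs.le, hst.le⟩
    linarith
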